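/- arXiv:2002.01871 — 7 statements merged into one kernel-verified Lean document; each statement's English description precedes it below -/
import Mathlib

section
/- Let F : ℝⁿ → ℝᵐ be differentiable on a neighborhood of a point x and twice differentiable at x, with Jacobian J. Let C(x) : ℝⁿ → ℝⁿ be the linear map determined by ⟨C(x)v, w⟩ = ⟨F(x), D²F(x)[v, w]⟩ for all v, w (i.e., C(x)v = Σᵢ Fᵢ(x)·∇²Fᵢ(x)v). Then the map s ↦ (J(x) − J(x − s))ᵀF(x) − C(x)s is o(‖s‖) as s → 0; equivalently, the structured secant vector y(s) = J(x)ᵀJ(x)s + (J(x) − J(x−s))ᵀF(x) satisfies H(x)s − y(s) = o(‖s‖) as s → 0, where H(x) = J(x)ᵀJ(x) + C(x) is the Hessian of f(y) = (1/2)‖F(y)‖² at x. -/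
open scoped RealInnerProductSpace Topology
open Asymptotics

/-- The structured secant vector `y(s) = J(x)ᵀJ(x)s + (J(x) − J(x−s))ᵀF(x)` approximates
the Hessian action `H(x)s = J(x)ᵀJ(x)s + C(x)s` to within `o(‖s‖)`: the map
`s ↦ (J(x) − J(x−s))ᵀF(x) − C(x)s` is `o(‖s‖)` as `s → 0`, where `C(x)` is the linear map
with `⟨C(x)v, w⟩ = ⟨F(x), D²F(x)[v,w]⟩`. -/
theorem stmt_5 (n m : ℕ) (F : EuclideanSpace ℝ (Fin n) → EuclideanSpace ℝ (Fin m))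
    (x : EuclideanSpace ℝ (Fin n))
    (J : EuclideanSpace ℝ (Fin n) → EuclideanSpace ℝ (Fin n) →L[ℝ] EuclideanSpace ℝ (Fin m))
    (hJ : ∀ᶠ y in 𝓝 x, HasFDerivAt F (J y) y)
    (J'' : EuclideanSpace ℝ (Fin n) →L[ℝ]
      EuclideanSpace ℝ (Fin n) →L[ℝ] EuclideanSpace ℝ (Fin m))
    (hJ'' : HasFDerivAt J J'' x)
    (C : EuclideanSpace ℝ (Fin n) →L[ℝ] EuclideanSpace ℝ (Fin n))
    (hC : ∀ v w, ⟪C v, w⟫ = ⟪F x, J'' v w⟫) :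
    (fun s : EuclideanSpace ℝ (Fin n) =>
        ContinuousLinearMap.adjoint (J x - J (x - s)) (F x) - C s)
      =o[𝓝 0] fun s => s := by
  have hC_adjoint : ∀ s, C s = ContinuousLinearMap.adjoint (J'' s) (F x) := fun s =>
    ext_inner_right ℝ fun w => by rw [hC, ContinuousLinearMap.adjoint_inner_left]
  have hneg : Filter.Tendsto (fun s : EuclideanSpace ℝ (Fin n) => -s) (𝓝 0) (𝓝 0) := by
    simpa using (continuous_neg (G := EuclideanSpace ℝ (Fin n))).tendsto 0
  have hrem : (fun s => J x - J (x - s) - J'' s) =o[𝓝 0] fun s => s := by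
    refine (((hasFDerivAt_iff_isLittleO_nhds_zero.mp hJ'').comp_tendsto hneg
      ).neg_left.neg_right).congr (fun s => ?_) (fun s => neg_neg s)
    simp only [Function.comp_apply, map_neg, ← sub_eq_add_neg]
    abel
  refine (IsBigO.of_bound ‖F x‖ (Filter.Eventually.of_forall fun s => ?_)).trans_isLittleO hrem
  rw [hC_adjoint, ← sub_apply, ← map_sub, mul_comm]
  exact (ContinuousLinearMap.le_opNorm _ _).trans_eq
    (by rw [LinearIsometryEquiv.norm_map])
end

section
/- Let θ ∈ (0,1), m₁ > 0, α > 0, let Q ≥ 1, η ∈ [0,1], G ≥ 0, and let P, f⁺, t be real numbers with t ≤ −m₁·G and f⁺ ≤ P + θ·α·t. Set Q⁺ = η·Q + 1 and P⁺ = (η·Q·P + f⁺)/Q⁺. Then P⁺ ≤ P − (θ·α·m₁·G)/Q⁺; in particular P⁺ ≤ P. -/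
/-- One-step decrease of the Zhang–Hager nonmonotone line-search averages:
with `Q⁺ = ηQ + 1` and `P⁺ = (ηQP + f⁺)/Q⁺`, the nonmonotone Armijo condition
`f⁺ ≤ P + θαt` and the sufficient-descent condition `t ≤ −m₁G` imply
`P⁺ ≤ P − θαm₁G/Q⁺ ≤ P`. -/
theorem stmt_6 (θ m₁ α Q η G P fplus t : ℝ)
    (hθ0 : 0 < θ) (hθ1 : θ < 1) (hm₁ : 0 < m₁) (hα : 0 < α)
    (hQ : 1 ≤ Q) (hη0 : 0 ≤ η) (hη1 : η ≤ 1) (hG : 0 ≤ G)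
    (ht : t ≤ -m₁ * G) (hf : fplus ≤ P + θ * α * t) :
    (η * Q * P + fplus) / (η * Q + 1) ≤ P - θ * α * m₁ * G / (η * Q + 1) ∧
      (η * Q * P + fplus) / (η * Q + 1) ≤ P := by
  have hQpos : 0 < η * Q + 1 := by positivity
  have hdescent : θ * α * t ≤ θ * α * (-m₁ * G) := by gcongr
  have hdecrease : (η * Q * P + fplus) / (η * Q + 1) ≤
      P - θ * α * m₁ * G / (η * Q + 1) := by
    rw [le_sub_iff_add_le, ← add_div, div_le_iff₀ hQpos]
    linarith
  have hnonneg : 0 ≤ θ * α * m₁ * G / (η * Q + 1) := by positivity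
  exact ⟨hdecrease, hdecrease.trans (sub_le_self P hnonneg)⟩
end

section
/- Let θ ∈ (0,1) and let f, P, Q, η, α, t : ℕ → ℝ be sequences such that for every k: η_k ∈ [0,1], α_k > 0, t_k ≤ 0, Q₀ = 1, P₀ = f₀, Q_{k+1} = η_k·Q_k + 1, P_{k+1} = (η_k·Q_k·P_k + f_{k+1})/Q_{k+1}, and f_{k+1} ≤ P_k + θ·α_k·t_k. Then for every k, f_k ≤ P_k, the sequence (P_k) is nonincreasing, and consequently f_k ≤ f₀ for all k. -/
/-- Along the Zhang–Hager nonmonotone line-search recursion with the nonmonotone Armijo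
condition and descent directions, one has `f_k ≤ P_k`, the reference values `P_k` are
nonincreasing, and hence `f_k ≤ f₀` for all `k`. -/
theorem stmt_7 (θ : ℝ) (hθ : θ ∈ Set.Ioo (0 : ℝ) 1) (f P Q η α t : ℕ → ℝ)
    (hη : ∀ k, η k ∈ Set.Icc (0 : ℝ) 1) (hα : ∀ k, 0 < α k) (ht : ∀ k, t k ≤ 0)
    (hQ0 : Q 0 = 1) (hP0 : P 0 = f 0)
    (hQ : ∀ k, Q (k + 1) = η k * Q k + 1)
    (hP : ∀ k, P (k + 1) = (η k * Q k * P k + f (k + 1)) / Q (k + 1))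
    (harmijo : ∀ k, f (k + 1) ≤ P k + θ * α k * t k) :
    (∀ k, f k ≤ P k) ∧ (∀ k, P (k + 1) ≤ P k) ∧ ∀ k, f k ≤ f 0 := by
  have hQpos : ∀ k, 0 < Q k := by
    intro k
    induction k with
    | zero => simp [hQ0]
    | succ k ih =>
      rw [hQ]
      have := mul_nonneg (hη k).1 ih.le
      linarith
  have hfP : ∀ k, f (k + 1) ≤ P k := fun k => by
    have := mul_nonpos_of_nonneg_of_nonpos (mul_pos hθ.1 (hα k)).le (ht k)
    linarith [harmijo k]
  have hP_le : ∀ k, P (k + 1) ≤ P k := fun k => by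
    rw [hP, div_le_iff₀ (hQpos _), hQ]
    linarith [hfP k]
  have hf_le : ∀ k, f k ≤ P k := by
    rintro (_ | k)
    · exact hP0.ge
    · rw [hP, le_div_iff₀ (hQpos _), hQ]
      have := mul_le_mul_of_nonneg_left (hfP k) (mul_nonneg (hη k).1 (hQpos k).le)
      linarith
  refine ⟨hf_le, hP_le, fun k => ?_⟩
  rw [← hP0]
  exact (hf_le k).trans (antitone_nat_of_succ_le hP_le k.zero_le)
end

section
/- Let θ ∈ (0,1) and let f, P, Q, η, α, t : ℕ → ℝ be sequences such that for every k: η_k ∈ [0,1], α_k > 0, t_k ≤ 0, Q₀ = 1, P₀ = f₀, Q_{k+1} = η_k·Q_k + 1, P_{k+1} = (η_k·Q_k·P_k + f_{k+1})/Q_{k+1}, and f_{k+1} ≤ P_k + θ·α_k·t_k. Then for every k, f_k ≤ P_k ≤ ψ_k, where ψ_k = (1/(k+1))·Σ_{i=0}^{k} f_i is the arithmetic mean of f₀, …, f_k. -/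
open Finset

/-- Along the Zhang–Hager nonmonotone line-search recursion with the nonmonotone Armijo
condition and descent directions, `f_k ≤ P_k ≤ ψ_k`, where `ψ_k` is the arithmetic mean
of `f₀, …, f_k`. -/
theorem stmt_8 (θ : ℝ) (hθ : θ ∈ Set.Ioo (0 : ℝ) 1) (f P Q η α t : ℕ → ℝ)
    (hη : ∀ k, η k ∈ Set.Icc (0 : ℝ) 1) (hα : ∀ k, 0 < α k) (ht : ∀ k, t k ≤ 0)
    (hQ0 : Q 0 = 1) (hP0 : P 0 = f 0)
    (hQ : ∀ k, Q (k + 1) = η k * Q k + 1)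
    (hP : ∀ k, P (k + 1) = (η k * Q k * P k + f (k + 1)) / Q (k + 1))
    (harmijo : ∀ k, f (k + 1) ≤ P k + θ * α k * t k) :
    ∀ k, f k ≤ P k ∧ P k ≤ (1 / (k + 1 : ℝ)) * ∑ i ∈ range (k + 1), f i := by
  have hQ_mem : ∀ k : ℕ, 1 ≤ Q k ∧ Q k ≤ k + 1 := by
    intro k
    induction k with
    | zero => simp [hQ0]
    | succ k ih =>
      obtain ⟨h0, h1⟩ := hη k
      rw [hQ k]
      push_cast
      constructor
      · nlinarith
      · nlinarith
  have hf_le : ∀ k, f (k + 1) ≤ P k := fun k =>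
    (harmijo k).trans (add_le_of_nonpos_right
      (mul_nonpos_of_nonneg_of_nonpos (mul_nonneg hθ.1.le (hα k).le) (ht k)))
  have hdecr : ∀ k, Q (k + 1) * (P k - P (k + 1)) = P k - f (k + 1) := by
    intro k
    have hne : Q (k + 1) ≠ 0 := (zero_lt_one.trans_le (hQ_mem (k + 1)).1).ne'
    have h := hP k
    rw [eq_div_iff hne] at h
    linear_combination P k * hQ k - h
  have hanti : ∀ k, 0 ≤ P k - P (k + 1) := by
    intro k
    refine nonneg_of_mul_nonneg_right ?_ (zero_lt_one.trans_le (hQ_mem (k + 1)).1)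
    rw [hdecr k]
    exact sub_nonneg.2 (hf_le k)
  have hsum : ∀ k : ℕ, P k * (k + 1) ≤ ∑ i ∈ range (k + 1), f i := by
    intro k
    induction k with
    | zero => simp [hP0]
    | succ k ih =>
      have h := mul_le_mul_of_nonneg_right (hQ_mem (k + 1)).2 (hanti k)
      rw [sum_range_succ]
      push_cast at h ⊢
      linarith [hdecr k]
  intro k
  constructor
  · cases k with
    | zero => exact hP0.ge
    | succ k =>
      have h := mul_le_mul_of_nonneg_right (hQ_mem (k + 1)).1 (hanti k)
      linarith [hdecr k]
  · rw [one_div_mul_eq_div, le_div_iff₀ (by positivity)]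
    exact hsum k
end

section
/- Let f, η : ℕ → ℝ with η_k ∈ [0,1] for all k, and let Q, P : ℕ → ℝ be defined by Q₀ = 1, P₀ = f₀, Q_{k+1} = η_k·Q_k + 1, P_{k+1} = (η_k·Q_k·P_k + f_{k+1})/Q_{k+1}. Then for every k, P_k is a convex combination of f₀, f₁, …, f_k: there exist real numbers λ₀, …, λ_k with λᵢ ≥ 0 for all i, Σ_{i=0}^{k} λᵢ = 1, and P_k = Σ_{i=0}^{k} λᵢ·f_i. -/
open Finset

/-- Each Zhang–Hager nonmonotone reference value `P_k` is a convex combination of the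
function values `f₀, f₁, …, f_k`. -/
theorem stmt_11 (f η Q P : ℕ → ℝ) (hη : ∀ k, η k ∈ Set.Icc (0 : ℝ) 1)
    (hQ0 : Q 0 = 1) (hP0 : P 0 = f 0)
    (hQ : ∀ k, Q (k + 1) = η k * Q k + 1)
    (hP : ∀ k, P (k + 1) = (η k * Q k * P k + f (k + 1)) / Q (k + 1)) :
    ∀ k, ∃ lam : ℕ → ℝ, (∀ i ≤ k, 0 ≤ lam i) ∧
      (∑ i ∈ range (k + 1), lam i = 1) ∧ P k = ∑ i ∈ range (k + 1), lam i * f i := by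
  have hQpos : ∀ k, 0 < Q k := by
    intro k
    induction k with
    | zero => simp [hQ0]
    | succ k ih =>
      rw [hQ]
      have := mul_nonneg (hη k).1 ih.le
      linarith
  intro k
  induction k with
  | zero => exact ⟨fun _ => 1, by simp, by simp, by simp [hP0]⟩
  | succ k ih =>
    obtain ⟨lam, hnonneg, hsum, hPk⟩ := ih
    have hpos := hQpos (k + 1)
    have hw : 0 ≤ η k * Q k / Q (k + 1) :=
      div_nonneg (mul_nonneg (hη k).1 (hQpos k).le) hpos.le
    have hold : ∀ i ∈ range (k + 1), i ≠ k + 1 := fun i hi => (mem_range.1 hi).ne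
    refine ⟨fun i => if i = k + 1 then 1 / Q (k + 1) else η k * Q k / Q (k + 1) * lam i,
      fun i hi => ?_, ?_, ?_⟩
    · dsimp only
      split_ifs with h
      · exact (one_div_pos.2 hpos).le
      · exact mul_nonneg hw (hnonneg i (by omega))
    · rw [sum_range_succ, sum_congr rfl fun i hi => if_neg (hold i hi), ← mul_sum, hsum,
        if_pos rfl, mul_one, ← add_div, ← hQ, div_self hpos.ne']
    · have hterm : ∀ i ∈ range (k + 1),
          (if i = k + 1 then 1 / Q (k + 1) else η k * Q k / Q (k + 1) * lam i) * f i =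
            η k * Q k / Q (k + 1) * (lam i * f i) := fun i hi => by
        rw [if_neg (hold i hi), mul_assoc]
      rw [sum_range_succ, sum_congr rfl hterm, ← mul_sum, ← hPk, hP]
      simp only [if_true]
      ring
end

section
/- Let F : ℝⁿ → ℝᵐ be continuously differentiable with Jacobian J, let f(x) = (1/2)‖F(x)‖², and let g = ∇f (so g(x) = J(x)ᵀF(x)). Fix x₀ ∈ ℝⁿ and assume: (A1) the level set D = {x : f(x) ≤ f(x₀)} is bounded; (A2) g is Lipschitz continuous on ℝⁿ with some constant L > 0. Let θ ∈ (0,1), 0 ≤ η_min ≤ η_max ≤ 1, m₁, m₂ > 0, and let sequences x_k, d_k, α_k, η_k, P_k, Q_k satisfy for every k: x_{k+1} = x_k + α_k d_k with x₀ as given; the sufficient-descent and boundedness conditions ⟨g(x_k), d_k⟩ ≤ −m₁‖g(x_k)‖² and ‖d_k‖ ≤ m₂‖g(x_k)‖; η_k ∈ [η_min, η_max]; Q₀ = 1, P₀ = f(x₀), Q_{k+1} = η_k Q_k + 1, P_{k+1} = (η_k Q_k P_k + f(x_{k+1}))/Q_{k+1}; α_k = 2^{−j_k} for some j_k ∈ ℕ,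 the nonmonotone Armijo condition f(x_k + α_k d_k) ≤ P_k + θ·α_k·⟨g(x_k), d_k⟩ holds, and either α_k = 1 or f(x_k + 2α_k d_k) > P_k + 2θ·α_k·⟨g(x_k), d_k⟩. Then the sequence {x_k} is contained in D and liminf_{k→∞} ‖g(x_k)‖ = 0. -/
open scoped RealInnerProductSpace
open Filter

/-- The descent lemma: a function with `L`-Lipschitz gradient lies below its quadratic model. -/
theorem le_add_inner_add_sq_of_lipschitz_gradient {E : Type*} [NormedAddCommGroup E]
    [InnerProductSpace ℝ E] {f : E → ℝ} {g : E → E} {L : ℝ}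
    (hf : ∀ y, HasFDerivAt f (innerSL ℝ (g y)) y)
    (hg : ∀ x y, ‖g x - g y‖ ≤ L * ‖x - y‖) (x v : E) :
    f (x + v) ≤ f x + ⟪g x, v⟫ + L / 2 * ‖v‖ ^ 2 := by
  let φ : ℝ → ℝ := fun t => f (x + t • v) - t * ⟪g x, v⟫ - L / 2 * ‖v‖ ^ 2 * t ^ 2
  have hφ : ∀ t, HasDerivAt φ (⟪g (x + t • v), v⟫ - ⟪g x, v⟫ - L * ‖v‖ ^ 2 * t) t := by
    intro t
    have hline : HasDerivAt (fun t : ℝ => x + t • v) v t := by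
      simpa using ((hasDerivAt_id t).smul_const v).const_add x
    have hcomp : HasDerivAt (fun t : ℝ => f (x + t • v)) ⟪g (x + t • v), v⟫ t := by
      simpa [Function.comp_def] using (hf (x + t • v)).comp_hasDerivAt t hline
    have hlin : HasDerivAt (fun t : ℝ => t * ⟪g x, v⟫) ⟪g x, v⟫ t := by
      simpa using (hasDerivAt_id t).mul_const ⟪g x, v⟫
    have hsq : HasDerivAt (fun t : ℝ => L / 2 * ‖v‖ ^ 2 * t ^ 2) (L * ‖v‖ ^ 2 * t) t := by
      refine ((hasDerivAt_pow 2 t).const_mul (L / 2 * ‖v‖ ^ 2)).congr_deriv ?_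
      push_cast
      ring
    exact (hcomp.sub hlin).sub hsq
  have hanti : AntitoneOn φ (Set.Ici 0) := by
    refine antitoneOn_of_deriv_nonpos (convex_Ici 0)
      (fun t _ => (hφ t).continuousAt.continuousWithinAt)
      (fun t _ => (hφ t).differentiableAt.differentiableWithinAt) fun t ht => ?_
    rw [interior_Ici, Set.mem_Ioi] at ht
    rw [(hφ t).deriv, ← inner_sub_left]
    have hLip : ‖g (x + t • v) - g x‖ ≤ L * (t * ‖v‖) := by
      simpa [norm_smul, abs_of_pos ht] using hg (x + t • v) x
    have := (real_inner_le_norm (g (x + t • v) - g x) v).trans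
      (mul_le_mul_of_nonneg_right hLip (norm_nonneg v))
    linarith
  have h := hanti (Set.mem_Ici.2 le_rfl) (Set.mem_Ici.2 zero_le_one) zero_le_one
  simp only [φ, one_smul, zero_smul, add_zero] at h
  linarith

/-- The derivative of the least-squares objective `(1 / 2) * ‖F y‖ ^ 2` is the pairing with
`(J y)† (F y)`. -/
theorem HasFDerivAt.half_norm_sq_adjoint {E G : Type*} [NormedAddCommGroup E]
    [InnerProductSpace ℝ E] [CompleteSpace E] [NormedAddCommGroup G] [InnerProductSpace ℝ G]
    [CompleteSpace G] {F : E → G} {J : E →L[ℝ] G} {y : E} (hF : HasFDerivAt F J y) :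
    HasFDerivAt (fun y => (1 / 2 : ℝ) * ‖F y‖ ^ 2)
      (innerSL ℝ (ContinuousLinearMap.adjoint J (F y))) y := by
  refine (hF.norm_sq.const_mul (1 / 2 : ℝ)).congr_fderiv ?_
  ext v
  simp [ContinuousLinearMap.adjoint_inner_left]

/-- A nonnegative sequence `P` decreasing by at least `β * a k ^ 2 / (k + 2)` at each step forces
`liminf a = 0`. -/
theorem liminf_eq_zero_of_harmonic_decrease {a P : ℕ → ℝ} {β : ℝ} (hβ : 0 < β)
    (ha : ∀ k, 0 ≤ a k) (hP : ∀ k, 0 ≤ P k)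
    (hdec : ∀ k : ℕ, P (k + 1) ≤ P k - β * a k ^ 2 / (k + 2)) :
    liminf a atTop = 0 := by
  have hsum : Summable fun k : ℕ => β * a k ^ 2 / (k + 2) := by
    refine summable_of_sum_range_le (c := P 0) (fun k => by positivity) fun k => ?_
    have : ∑ i ∈ Finset.range k, β * a i ^ 2 / (i + 2) ≤ P 0 - P k := by
      rw [← Finset.sum_range_sub' P k]
      exact Finset.sum_le_sum fun i _ => by linarith [hdec i]
    linarith [hP k]
  have hfreq : ∀ ε > 0, ∃ᶠ k in atTop, a k ≤ ε := by
    intro ε hε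
    by_contra hcon
    rw [not_frequently] at hcon
    have h : Summable fun k : ℕ => 1 / ((k : ℝ) + 2) := by
      refine Summable.of_norm_bounded_eventually_nat (hsum.mul_left (β * ε ^ 2)⁻¹) ?_
      filter_upwards [hcon] with k hk
      have hk : ε ≤ a k := (not_le.1 hk).le
      rw [Real.norm_of_nonneg (by positivity), ← mul_div_assoc]
      gcongr
      rw [inv_mul_eq_div, one_le_div (by positivity)]
      gcongr
    have h' : Summable fun k : ℕ => 1 / ((k + 2 : ℕ) : ℝ) := by simpa using h
    exact Real.not_summable_one_div_natCast
      ((summable_nat_add_iff (f := fun k : ℕ => 1 / (k : ℝ)) 2).1 h')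
  have hbdd : IsBoundedUnder (· ≥ ·) atTop a := isBoundedUnder_of ⟨0, ha⟩
  refine le_antisymm (le_of_forall_pos_le_add fun ε hε => ?_) ?_
  · rw [zero_add]
    exact liminf_le_of_frequently_le (hfreq ε hε) hbdd
  · exact le_liminf_of_le (IsCoboundedUnder.of_frequently_le (hfreq 1 one_pos))
      (Eventually.of_forall ha)

/-- A trial step rejected by the Armijo test has length bounded below, so the accepted step, half
of it, does too. -/
theorem backtracking_step_lower_bound {E : Type*} [NormedAddCommGroup E]
    [InnerProductSpace ℝ E] {f : E → ℝ} {g : E → E} {L : ℝ}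
    (hf : ∀ y, HasFDerivAt f (innerSL ℝ (g y)) y) (hL : 0 < L)
    (hg : ∀ x y, ‖g x - g y‖ ≤ L * ‖x - y‖) {θ m₁ m₂ a p : ℝ} (hθ : θ < 1) (hm₂ : 0 < m₂)
    {x d : E} (ha : 0 < a) (hdesc : ⟪g x, d⟫ ≤ -m₁ * ‖g x‖ ^ 2) (hd : ‖d‖ ≤ m₂ * ‖g x‖)
    (hp : f x ≤ p) (hrej : p + 2 * θ * a * ⟪g x, d⟫ < f (x + (2 * a) • d)) :
    (1 - θ) * m₁ / (L * m₂ ^ 2) ≤ a := by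
  have hquad := le_add_inner_add_sq_of_lipschitz_gradient hf hg x ((2 * a) • d)
  rw [inner_smul_right, norm_smul, Real.norm_of_nonneg (by positivity)] at hquad
  have hd2 : ‖d‖ ^ 2 ≤ m₂ ^ 2 * ‖g x‖ ^ 2 := by
    rw [← mul_pow]
    gcongr
  have h1 : 2 * a * ((1 - θ) * -⟪g x, d⟫) < 2 * a * (L * a * ‖d‖ ^ 2) := by linarith
  have h2 : (1 - θ) * -⟪g x, d⟫ < L * a * ‖d‖ ^ 2 := lt_of_mul_lt_mul_left h1 (by positivity)
  have h3 : (1 - θ) * (m₁ * ‖g x‖ ^ 2) ≤ (1 - θ) * -⟪g x, d⟫ :=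
    mul_le_mul_of_nonneg_left (by linarith) (by linarith)
  have h4 : L * a * ‖d‖ ^ 2 ≤ L * a * (m₂ ^ 2 * ‖g x‖ ^ 2) := by gcongr
  have h5 : (1 - θ) * m₁ * ‖g x‖ ^ 2 < a * (L * m₂ ^ 2) * ‖g x‖ ^ 2 := by linarith
  rw [div_le_iff₀ (by positivity)]
  exact (lt_of_mul_lt_mul_right h5 (by positivity)).le

/-- Global convergence of the ASDH algorithm: under boundedness of the level set and
Lipschitz continuity of the gradient, the iterates generated by descent directions with
the Zhang–Hager nonmonotone backtracking line search stay in the level set and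
`liminf_{k→∞} ‖g(x_k)‖ = 0`. -/
theorem stmt_14 (n m : ℕ)
    (F : EuclideanSpace ℝ (Fin n) → EuclideanSpace ℝ (Fin m))
    (J : EuclideanSpace ℝ (Fin n) → EuclideanSpace ℝ (Fin n) →L[ℝ] EuclideanSpace ℝ (Fin m))
    (hJ : ∀ y, HasFDerivAt F (J y) y) (hJcont : Continuous J)
    (f : EuclideanSpace ℝ (Fin n) → ℝ) (hf : ∀ y, f y = (1 / 2 : ℝ) * ‖F y‖ ^ 2)
    (g : EuclideanSpace ℝ (Fin n) → EuclideanSpace ℝ (Fin n))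
    (hg : ∀ y, g y = ContinuousLinearMap.adjoint (J y) (F y))
    (x₀ : EuclideanSpace ℝ (Fin n))
    (hlevel : Bornology.IsBounded {x | f x ≤ f x₀})
    (L : ℝ) (hL : 0 < L) (hgLip : ∀ x y, ‖g x - g y‖ ≤ L * ‖x - y‖)
    (θ ηmin ηmax m₁ m₂ : ℝ) (hθ : θ ∈ Set.Ioo (0 : ℝ) 1)
    (hηmin : 0 ≤ ηmin) (hηminmax : ηmin ≤ ηmax) (hηmax : ηmax ≤ 1)
    (hm₁ : 0 < m₁) (hm₂ : 0 < m₂)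
    (x d : ℕ → EuclideanSpace ℝ (Fin n)) (α η P Q : ℕ → ℝ) (j : ℕ → ℕ)
    (hx0 : x 0 = x₀) (hx : ∀ k, x (k + 1) = x k + α k • d k)
    (hdesc : ∀ k, ⟪g (x k), d k⟫ ≤ -m₁ * ‖g (x k)‖ ^ 2)
    (hdbd : ∀ k, ‖d k‖ ≤ m₂ * ‖g (x k)‖)
    (hη : ∀ k, η k ∈ Set.Icc ηmin ηmax)
    (hQ0 : Q 0 = 1) (hP0 : P 0 = f x₀)
    (hQ : ∀ k, Q (k + 1) = η k * Q k + 1)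
    (hP : ∀ k, P (k + 1) = (η k * Q k * P k + f (x (k + 1))) / Q (k + 1))
    (hα : ∀ k, α k = 1 / 2 ^ j k)
    (harmijo : ∀ k, f (x k + α k • d k) ≤ P k + θ * α k * ⟪g (x k), d k⟫)
    (hback : ∀ k, α k = 1 ∨
      f (x k + (2 * α k) • d k) > P k + 2 * θ * α k * ⟪g (x k), d k⟫) :
    (∀ k, x k ∈ {y | f y ≤ f x₀}) ∧
      Filter.liminf (fun k => ‖g (x k)‖) Filter.atTop = 0 := by
  have hfderiv : ∀ y, HasFDerivAt f (innerSL ℝ (g y)) y := fun y => by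
    rw [hg y, funext hf]
    exact (hJ y).half_norm_sq_adjoint
  have hf0 : ∀ y, 0 ≤ f y := fun y => by rw [hf]; positivity
  have hη0 : ∀ k, 0 ≤ η k := fun k => hηmin.trans (hη k).1
  have hη1 : ∀ k, η k ≤ 1 := fun k => (hη k).2.trans hηmax
  have hα0 : ∀ k, 0 < α k := fun k => by rw [hα]; positivity
  have hQbd : ∀ k, 1 ≤ Q k ∧ Q k ≤ k + 1 := by
    intro k
    induction k with
    | zero => simp [hQ0]
    | succ k ih =>
      have h1 := mul_nonneg (hη0 k) (zero_le_one.trans ih.1)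
      have h2 := mul_le_of_le_one_left (zero_le_one.trans ih.1) (hη1 k)
      rw [hQ]
      push_cast
      constructor <;> linarith [ih.2]
  have hQpos : ∀ k, 0 < Q k := fun k => zero_lt_one.trans_le (hQbd k).1
  have hPrec : ∀ k, P (k + 1) = P k - (P k - f (x (k + 1))) / Q (k + 1) := by
    intro k
    have := (hQpos (k + 1)).ne'
    rw [hP, eq_sub_iff_add_eq, ← add_div, div_eq_iff this, hQ]
    ring
  have hstep : ∀ k, θ * α k * (m₁ * ‖g (x k)‖ ^ 2) ≤ P k - f (x (k + 1)) := by
    intro k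
    have h := harmijo k
    rw [← hx] at h
    have := mul_le_mul_of_nonneg_left (hdesc k) (mul_pos hθ.1 (hα0 k)).le
    linarith
  have hgap : ∀ k, 0 ≤ P k - f (x (k + 1)) := fun k =>
    (mul_nonneg (mul_pos hθ.1 (hα0 k)).le (by positivity)).trans (hstep k)
  have hfP : ∀ k, f (x k) ≤ P k := by
    intro k
    cases k with
    | zero => rw [hP0, hx0]
    | succ k =>
      have := div_le_self (hgap k) (hQbd (k + 1)).1
      linarith [hPrec k]
  have hPanti : Antitone P := antitone_nat_of_succ_le fun k => by
    linarith [hPrec k, div_nonneg (hgap k) (hQpos (k + 1)).le]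
  refine ⟨fun k => (hfP k).trans (hP0 ▸ hPanti (Nat.zero_le k)), ?_⟩
  set c := min 1 ((1 - θ) * m₁ / (L * m₂ ^ 2))
  have hc0 : 0 < c := lt_min one_pos
    (div_pos (mul_pos (sub_pos.2 hθ.2) hm₁) (by positivity))
  have hcα : ∀ k, c ≤ α k := by
    intro k
    rcases hback k with h | h
    · exact h ▸ min_le_left _ _
    · exact (min_le_right _ _).trans (backtracking_step_lower_bound hfderiv hL hgLip hθ.2 hm₂
        (hα0 k) (hdesc k) (hdbd k) (hfP k) h)
  refine liminf_eq_zero_of_harmonic_decrease (β := θ * c * m₁) (P := P)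
    (mul_pos (mul_pos hθ.1 hc0) hm₁) (fun k => norm_nonneg _)
    (fun k => (hf0 _).trans (hfP k)) fun k => ?_
  rw [hPrec k]
  have hQk : Q (k + 1) ≤ k + 2 := by
    have := (hQbd (k + 1)).2
    push_cast at this
    linarith
  have hnum : θ * c * m₁ * ‖g (x k)‖ ^ 2 ≤ P k - f (x (k + 1)) := by
    refine le_trans ?_ (hstep k)
    rw [mul_assoc (θ * c)]
    exact mul_le_mul_of_nonneg_right (mul_le_mul_of_nonneg_left (hcα k) hθ.1.le) (by positivity)
  exact sub_le_sub_left (div_le_div₀ (hgap k) hnum (hQpos (k + 1)) hQk) _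
end

section
/- Let F : ℝⁿ → ℝᵐ be continuously differentiable with Jacobian J, let f(x) = (1/2)‖F(x)‖², and let g = ∇f (so g(x) = J(x)ᵀF(x)). Fix x₀ ∈ ℝⁿ and assume: (A1) the level set D = {x : f(x) ≤ f(x₀)} is bounded; (A2) g is Lipschitz continuous on ℝⁿ with some constant L > 0. Let θ ∈ (0,1), 0 ≤ η_min ≤ η_max < 1 (strict inequality η_max < 1), m₁, m₂ > 0, and let sequences x_k, d_k, α_k, η_k, P_k, Q_k satisfy for every k: x_{k+1} = x_k + α_k d_k with x₀ as given; ⟨g(x_k), d_k⟩ ≤ −m₁‖g(x_k)‖² and ‖d_k‖ ≤ m₂‖g(x_k)‖; η_k ∈ [η_min, η_max]; Q₀ = 1, P₀ = f(x₀), Q_{k+1} = η_k Q_k + 1, P_{k+1} = (η_k Q_k P_k + f(x_{k+1}))/Q_{k+1}; α_k = 2^{−j_k} for some j_k ∈ ℕ, the nonmonotone Armijo condition f(x_k + α_k d_k) ≤ P_k + θ·α_k·⟨g(x_k), d_k⟩ holds, and either α_k = 1 or f(x_k + 2α_k d_k) > P_k + 2θ·α_k·⟨g(x_k), d_k⟩.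 Then lim_{k→∞} ‖g(x_k)‖ = 0. -/
open scoped RealInnerProductSpace Topology
open Filter

/-- The half squared norm of a differentiable map has gradient `J(y)ᵀ F(y)`. -/
theorem hasFDerivAt_half_norm_sq {E G : Type*} [NormedAddCommGroup E] [InnerProductSpace ℝ E]
    [CompleteSpace E] [NormedAddCommGroup G] [InnerProductSpace ℝ G] [CompleteSpace G]
    {F : E → G} {J : E →L[ℝ] G} {y : E} (hF : HasFDerivAt F J y) :
    HasFDerivAt (fun z => (1 / 2 : ℝ) * ‖F z‖ ^ 2)
      (innerSL ℝ (ContinuousLinearMap.adjoint J (F y))) y := by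
  refine (hF.norm_sq.const_mul (1 / 2 : ℝ)).congr_fderiv ?_
  ext v
  simp [ContinuousLinearMap.adjoint_inner_left]

/-- First-order upper model of a function with Lipschitz gradient. -/
theorem le_add_inner_add_mul_norm_sq {E : Type*} [NormedAddCommGroup E] [InnerProductSpace ℝ E]
    {f : E → ℝ} {g : E → E} {L : ℝ} (hL : 0 ≤ L)
    (hf : ∀ y, HasFDerivAt f (innerSL ℝ (g y)) y)
    (hg : ∀ x y, ‖g x - g y‖ ≤ L * ‖x - y‖) (x v : E) :
    f (x + v) ≤ f x + ⟪g x, v⟫ + L * ‖v‖ ^ 2 := by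
  have hline (t : ℝ) : HasDerivAt (fun s : ℝ => f (x + s • v)) ⟪g (x + t • v), v⟫ t := by
    have h : HasDerivAt (fun s : ℝ => x + s • v) v t := by
      simpa using ((hasDerivAt_id t).smul_const v).const_add x
    simpa [Function.comp_def] using (hf (x + t • v)).comp_hasDerivAt t h
  obtain ⟨t, ht, hmv⟩ := exists_hasDerivAt_eq_slope (fun s : ℝ => f (x + s • v))
    (fun s => ⟪g (x + s • v), v⟫) zero_lt_one
    (fun s _ => (hline s).continuousAt.continuousWithinAt) (fun s _ => hline s)
  simp only [one_smul, zero_smul, add_zero, sub_zero, div_one] at hmv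
  have hinner : ⟪g (x + t • v) - g x, v⟫ ≤ L * ‖v‖ ^ 2 := by
    calc ⟪g (x + t • v) - g x, v⟫ ≤ ‖g (x + t • v) - g x‖ * ‖v‖ := real_inner_le_norm _ _
      _ ≤ (L * ‖v‖) * ‖v‖ := by
        gcongr
        refine (hg _ _).trans ?_
        rw [add_sub_cancel_left, norm_smul, Real.norm_of_nonneg ht.1.le]
        gcongr
        exact mul_le_of_le_one_left (norm_nonneg v) ht.2.le
      _ = L * ‖v‖ ^ 2 := by ring
  rw [inner_sub_left] at hinner
  linarith

/-- A nonnegative sequence decreasing by at least `β * u k ^ 2` at each step forces `u → 0`. -/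
theorem tendsto_zero_of_sufficient_decrease {P u : ℕ → ℝ} {β : ℝ} (hβ : 0 < β)
    (hP : ∀ k, 0 ≤ P k) (hdec : ∀ k, P (k + 1) ≤ P k - β * u k ^ 2) :
    Tendsto u atTop (𝓝 0) := by
  have hanti : Antitone P := antitone_nat_of_succ_le fun k => by
    have := hdec k
    have : 0 ≤ β * u k ^ 2 := by positivity
    linarith
  have hlim := tendsto_atTop_ciInf hanti ⟨0, by rintro _ ⟨k, rfl⟩; exact hP k⟩
  have hdiff : Tendsto (fun k => (P k - P (k + 1)) / β) atTop (𝓝 0) := by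
    simpa using (hlim.sub (hlim.comp (tendsto_add_atTop_nat 1))).div_const β
  have hsq : Tendsto (fun k => u k ^ 2) atTop (𝓝 0) :=
    squeeze_zero (fun k => sq_nonneg _)
      (fun k => by rw [le_div_iff₀ hβ]; linarith [hdec k]) hdiff
  rw [tendsto_zero_iff_abs_tendsto_zero]
  simpa [Function.comp_def, Real.sqrt_sq_eq_abs] using hsq.sqrt

/-- Strong global convergence of the ASDH algorithm: under boundedness of the level set,
Lipschitz continuity of the gradient and `η_max < 1`, the whole sequence of gradient
norms of the iterates generated with the Zhang–Hager nonmonotone backtracking line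
search converges to zero: `lim_{k→∞} ‖g(x_k)‖ = 0`. -/
theorem stmt_15 (n m : ℕ)
    (F : EuclideanSpace ℝ (Fin n) → EuclideanSpace ℝ (Fin m))
    (J : EuclideanSpace ℝ (Fin n) → EuclideanSpace ℝ (Fin n) →L[ℝ] EuclideanSpace ℝ (Fin m))
    (hJ : ∀ y, HasFDerivAt F (J y) y) (hJcont : Continuous J)
    (f : EuclideanSpace ℝ (Fin n) → ℝ) (hf : ∀ y, f y = (1 / 2 : ℝ) * ‖F y‖ ^ 2)
    (g : EuclideanSpace ℝ (Fin n) → EuclideanSpace ℝ (Fin n))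
    (hg : ∀ y, g y = ContinuousLinearMap.adjoint (J y) (F y))
    (x₀ : EuclideanSpace ℝ (Fin n))
    (hlevel : Bornology.IsBounded {x | f x ≤ f x₀})
    (L : ℝ) (hL : 0 < L) (hgLip : ∀ x y, ‖g x - g y‖ ≤ L * ‖x - y‖)
    (θ ηmin ηmax m₁ m₂ : ℝ) (hθ : θ ∈ Set.Ioo (0 : ℝ) 1)
    (hηmin : 0 ≤ ηmin) (hηminmax : ηmin ≤ ηmax) (hηmax : ηmax < 1)
    (hm₁ : 0 < m₁) (hm₂ : 0 < m₂)
    (x d : ℕ → EuclideanSpace ℝ (Fin n)) (α η P Q : ℕ → ℝ) (j : ℕ → ℕ)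
    (hx0 : x 0 = x₀) (hx : ∀ k, x (k + 1) = x k + α k • d k)
    (hdesc : ∀ k, ⟪g (x k), d k⟫ ≤ -m₁ * ‖g (x k)‖ ^ 2)
    (hdbd : ∀ k, ‖d k‖ ≤ m₂ * ‖g (x k)‖)
    (hη : ∀ k, η k ∈ Set.Icc ηmin ηmax)
    (hQ0 : Q 0 = 1) (hP0 : P 0 = f x₀)
    (hQ : ∀ k, Q (k + 1) = η k * Q k + 1)
    (hP : ∀ k, P (k + 1) = (η k * Q k * P k + f (x (k + 1))) / Q (k + 1))
    (hα : ∀ k, α k = 1 / 2 ^ j k)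
    (harmijo : ∀ k, f (x k + α k • d k) ≤ P k + θ * α k * ⟪g (x k), d k⟫)
    (hback : ∀ k, α k = 1 ∨
      f (x k + (2 * α k) • d k) > P k + 2 * θ * α k * ⟪g (x k), d k⟫) :
    Filter.Tendsto (fun k => ‖g (x k)‖) Filter.atTop (𝓝 0) := by
  obtain ⟨hθ0, hθ1⟩ := hθ
  have hfderiv : ∀ y, HasFDerivAt f (innerSL ℝ (g y)) y := fun y => by
    rw [hg y, funext hf]
    exact hasFDerivAt_half_norm_sq (hJ y)
  have hmodel := le_add_inner_add_mul_norm_sq hL.le hfderiv hgLip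
  have hη0 (k) : 0 ≤ η k := hηmin.trans (hη k).1
  have hQ1 (k) : 1 ≤ Q k := by
    induction k with
    | zero => exact hQ0.ge
    | succ k ih =>
      rw [hQ k]
      have := mul_nonneg (hη0 k) (zero_le_one.trans ih)
      linarith
  have hQub (k) : (1 - ηmax) * Q k ≤ 1 := by
    induction k with
    | zero => rw [hQ0]; linarith
    | succ k ih =>
      rw [hQ k]
      have h1 : η k * Q k ≤ ηmax * Q k :=
        mul_le_mul_of_nonneg_right (hη k).2 (zero_le_one.trans (hQ1 k))
      have hηm0 := hηmin.trans hηminmax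
      nlinarith [mul_le_mul_of_nonneg_left h1 (sub_nonneg.2 hηmax.le),
        mul_le_mul_of_nonneg_left ih hηm0]
  have hα0 (k) : 0 < α k := by rw [hα k]; positivity
  have hstep (k) : f (x (k + 1)) ≤ P k - θ * α k * (m₁ * ‖g (x k)‖ ^ 2) := by
    rw [hx k]
    have := mul_le_mul_of_nonneg_left (hdesc k) (mul_pos hθ0 (hα0 k)).le
    linarith [harmijo k]
  have hPmul (k) : P (k + 1) * Q (k + 1) = η k * Q k * P k + f (x (k + 1)) := by
    rw [hP k, div_mul_cancel₀ _ (zero_lt_one.trans_le (hQ1 (k + 1))).ne']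
  have hfP (k) : f (x k) ≤ P k := by
    cases k with
    | zero => rw [hP0, hx0]
    | succ k =>
      have hdecr : f (x (k + 1)) ≤ P k := by
        have : 0 ≤ θ * α k * (m₁ * ‖g (x k)‖ ^ 2) := by have := hα0 k; positivity
        linarith [hstep k]
      have hηQ : 0 ≤ η k * Q k := mul_nonneg (hη0 k) (zero_le_one.trans (hQ1 k))
      refine le_of_mul_le_mul_right ?_ (zero_lt_one.trans_le (hQ1 (k + 1)))
      rw [hPmul, hQ k]
      linarith [mul_le_mul_of_nonneg_left hdecr hηQ]
  have hf0 (y) : 0 ≤ f y := by rw [hf y]; positivity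
  set c := min 1 ((1 - θ) * m₁ / (2 * L * m₂ ^ 2)) with hc
  have hθ' : 0 < 1 - θ := sub_pos.2 hθ1
  have hη' : 0 < 1 - ηmax := sub_pos.2 hηmax
  have hc0 : 0 < c := lt_min one_pos (by positivity)
  have hαc (k) : c ≤ α k := by
    rcases hback k with h | h
    · exact h ▸ min_le_left _ _
    · refine (min_le_right _ _).trans ?_
      rw [div_le_iff₀ (by positivity)]
      have hup := hmodel (x k) ((2 * α k) • d k)
      have hαk := hα0 k
      rw [real_inner_smul_right, norm_smul, Real.norm_of_nonneg (by positivity)] at hup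
      have hd2 : ‖d k‖ ^ 2 ≤ m₂ ^ 2 * ‖g (x k)‖ ^ 2 := by
        rw [← mul_pow]
        exact pow_le_pow_left₀ (norm_nonneg _) (hdbd k) 2
      have hmain : 2 * α k * ((1 - θ) * -⟪g (x k), d k⟫) < 2 * α k * (2 * L * α k * ‖d k‖ ^ 2) := by
        linarith [hfP k]
      have hmain' := lt_of_mul_lt_mul_left hmain (by positivity)
      have h1 : 2 * L * α k * ‖d k‖ ^ 2 ≤ 2 * L * α k * (m₂ ^ 2 * ‖g (x k)‖ ^ 2) := by gcongr
      have h2 := mul_le_mul_of_nonneg_left (hdesc k) hθ'.le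
      have h3 : (1 - θ) * m₁ * ‖g (x k)‖ ^ 2 < α k * (2 * L * m₂ ^ 2) * ‖g (x k)‖ ^ 2 := by
        linarith
      exact (lt_of_mul_lt_mul_right h3 (by positivity)).le
  refine tendsto_zero_of_sufficient_decrease (P := P) (β := θ * c * m₁ * (1 - ηmax))
    (by positivity) (fun k => (hf0 _).trans (hfP k)) fun k => ?_
  refine le_of_mul_le_mul_right ?_ (zero_lt_one.trans_le (hQ1 (k + 1)))
  have h1 : θ * c * (m₁ * ‖g (x k)‖ ^ 2) ≤ θ * α k * (m₁ * ‖g (x k)‖ ^ 2) := by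
    gcongr
    exact hαc k
  have h2 : θ * c * (m₁ * ‖g (x k)‖ ^ 2) * ((1 - ηmax) * Q (k + 1)) ≤
      θ * c * (m₁ * ‖g (x k)‖ ^ 2) :=
    mul_le_of_le_one_right (by positivity) (hQub (k + 1))
  have h3 : P k * Q (k + 1) = P k * (η k * Q k + 1) := by rw [hQ k]
  rw [hPmul]
  linarith [hstep k]
end
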